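/- There exists an FSA S with deadlock states and a set T_f of faulty events such that S is T_f-predictable, but the FSA obtained from S by adding at its deadlock states self-loops labeled by an unobservable non-faulty event is not T_f-predictable. In particular, the FSA S_2 with states {x_0, x_1, x_2}, initial state x_0, events {f, u} both unobservable (label ε), T_f = {f}, and transitions (x_0, f, x_1), (x_0, u, x_2) is T_f-predictable, while S_2 with added self-loops (x_1, u, x_1) and (x_2, u, x_2) is not T_f-predictable. -/

import Mathlib

namespace DES

/-- Run of a labelled transition system along a finite word of events. -/
inductive RunRel {S : Type*} {E : Type*} (δ : S → E → S → Prop) : S → List E → S → Prop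
  | nil (x : S) : RunRel δ x [] x
  | cons {x y z : S} {e : E} {w : List E} :
      δ x e y → RunRel δ y w z → RunRel δ x (e :: w) z

/-- A labelling function (with `none` playing the role of the empty label ε)
extended to words by concatenation (ε's disappear). -/
def obsW {T : Type*} {Λ : Type*} (ℓ : T → Option Λ) (w : List T) : List Λ :=
  w.filterMap ℓ

/-- A finite-state automaton (FSA) `S = (X, T, X₀, δ, Σ, ℓ)`:
states `X`, events `T`, initial states `init`, transition relation `trans`,
labels `Λ`, labelling function `lbl` (with `none` = ε, i.e. unobservable). -/
structure FSA (X : Type*) (T : Type*) (Λ : Type*) where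
  init : Set X
  trans : Set (X × T × X)
  lbl : T → Option Λ

namespace FSA

variable {X : Type*} {T : Type*} {Λ : Type*}

def step (A : FSA X T Λ) (x : X) (t : T) (y : X) : Prop := (x, t, y) ∈ A.trans

/-- extension of the transition relation to words. -/
def Run (A : FSA X T Λ) : X → List T → X → Prop := RunRel A.step

/-- `L(S)`: finite event sequences generated from initial states. -/
def Lang (A : FSA X T Λ) : Set (List T) := {w | ∃ x0 ∈ A.init, ∃ x, A.Run x0 w x}

def InfRun (A : FSA X T Λ) (x : ℕ → X) (s : ℕ → T) : Prop :=
  x 0 ∈ A.init ∧ ∀ n, A.step (x n) (s n) (x (n + 1))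

/-- `L^ω(S)`: infinite event sequences generated from initial states. -/
def LangW (A : FSA X T Λ) : Set (ℕ → T) := {s | ∃ x, A.InfRun x s}

/-- current-state estimate `M_O(S, σ)` under the observation map `O`. -/
def est (A : FSA X T Λ) (O : T → Option Λ) (σ : List Λ) : Set X :=
  {x | ∃ x0 ∈ A.init, ∃ w : List T, obsW O w = σ ∧ A.Run x0 w x}

/-- `y` is reachable from `x` (by a nonempty word). -/
def Reach (A : FSA X T Λ) (x y : X) : Prop := ∃ w : List T, w ≠ [] ∧ A.Run x w y

/-- `y` lies on a transition cycle. -/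
def OnCycle (A : FSA X T Λ) (y : X) : Prop := ∃ w : List T, w ≠ [] ∧ A.Run y w y

/-- the normal sub-automaton: all faulty transitions removed. -/
def normal (A : FSA X T Λ) (Tf : Set T) : FSA X T Λ :=
  ⟨A.init, {tr | tr ∈ A.trans ∧ tr.2.1 ∉ Tf}, A.lbl⟩

/-- local automaton: same data, re-labelled by a local observation map. -/
def localAut (A : FSA X T Λ) (O : T → Option Λ) : FSA X T Λ :=
  ⟨A.init, A.trans, O⟩

end FSA

/-- local observation map of an observer with observable event set `To`:
it sees the global label on events of `To` and nothing otherwise. -/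
noncomputable def localObs {T : Type*} {Λ : Type*} (ℓ : T → Option Λ) (To : Set T) :
    T → Option Λ :=
  fun t => @ite _ (t ∈ To) (Classical.propDecidable _) (ℓ t) none

/-- the first `n` events of an infinite event sequence. -/
def pre {T : Type*} (s : ℕ → T) (n : ℕ) : List T := (List.range n).map s

/-- `s ∈ T*T_f`: the word `s` ends with a faulty event. -/
def endsFaulty {T : Type*} (Tf : Set T) (s : List T) : Prop :=
  ∃ (s₁ : List T) (t : T), t ∈ Tf ∧ s = s₁ ++ [t]

/-- `T_f ∈ s`: the word `s` contains a faulty event. -/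
def hasFault {T : Type*} (Tf : Set T) (s : List T) : Prop := ∃ t ∈ s, t ∈ Tf

namespace FSA

variable {X : Type*} {T : Type*} {Λ : Type*} {L : ℕ}

/-- O-co-detectability (Definition CoDet). -/
def CoDetectable (A : FSA X T Λ) (O : Fin L → T → Option Λ) : Prop :=
  ∃ k : ℕ, ∀ s ∈ A.LangW, ∃ i : Fin L, ∀ n : ℕ,
    k ≤ (obsW (O i) (pre s n)).length →
    (A.est (O i) (obsW (O i) (pre s n))).ncard = 1

/-- strong detectability (Definition StrDet). -/
def StronglyDetectable (A : FSA X T Λ) : Prop :=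
  ∃ k : ℕ, ∀ s ∈ A.LangW, ∀ n : ℕ,
    k ≤ (obsW A.lbl (pre s n)).length →
    (A.est A.lbl (obsW A.lbl (pre s n))).ncard = 1

/-- (O, T_f)-co-diagnosability (Definition CoDiag). -/
def CoDiagnosable (A : FSA X T Λ) (O : Fin L → T → Option Λ) (Tf : Set T) : Prop :=
  ∃ k : ℕ, ∀ s s' : List T, s ∈ A.Lang → endsFaulty Tf s → s ++ s' ∈ A.Lang →
    k ≤ s'.length →
    ∃ i : Fin L, ∀ s'' ∈ A.Lang, obsW (O i) s'' = obsW (O i) (s ++ s') → hasFault Tf s''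

/-- T_f-diagnosability (Definition Diag). -/
def Diagnosable (A : FSA X T Λ) (Tf : Set T) : Prop :=
  ∃ k : ℕ, ∀ s s' : List T, s ∈ A.Lang → endsFaulty Tf s → s ++ s' ∈ A.Lang →
    k ≤ s'.length →
    ∀ s'' ∈ A.Lang, obsW A.lbl s'' = obsW A.lbl (s ++ s') → hasFault Tf s''

/-- (O, T_f)-co-predictability (Definition CoPred). -/
def CoPredictable (A : FSA X T Λ) (O : Fin L → T → Option Λ) (Tf : Set T) : Prop :=
  ∃ k : ℕ, ∀ s ∈ A.Lang, endsFaulty Tf s →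
    ∃ s' : List T, s' <+: s ∧ ¬ hasFault Tf s' ∧
      ∃ i : Fin L, ∀ u v : List T, u ++ v ∈ A.Lang → obsW (O i) s' = obsW (O i) u →
        ¬ hasFault Tf u → k ≤ v.length → hasFault Tf v

/-- T_f-predictability (Definition Pred). -/
def Predictable (A : FSA X T Λ) (Tf : Set T) : Prop :=
  ∃ k : ℕ, ∀ s ∈ A.Lang, endsFaulty Tf s →
    ∃ s' : List T, s' <+: s ∧ ¬ hasFault Tf s' ∧
      ∀ u v : List T, u ++ v ∈ A.Lang → obsW A.lbl s' = obsW A.lbl u →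
        ¬ hasFault Tf u → k ≤ v.length → hasFault Tf v

end FSA

section CC

variable {T : Type*} {Λ : Type*} {L : ℕ}

/-- labelling extended to `Option T` (with `none` = ε). -/
def obsE (ℓ : T → Option Λ) : Option T → Option Λ := fun t? => t?.bind ℓ

/-- one optional step: `none` = stay put, `some t` = take a `t`-transition. -/
def stepOpt {X : Type*} (tr : Set (X × T × X)) : X → Option T → X → Prop :=
  fun x t? y =>
    match t? with
    | none => x = y
    | some t => (x, t, y) ∈ tr

/-- validity of a composite event of the concurrent composition,
restricted to the "active" local components `act`. -/
def ccEventOn (ℓs : Fin L → T → Option Λ) (act : Fin L → Prop)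
    (t0 : Option T) (ts : Fin L → Option T) : Prop :=
  ((∀ j, act j → obsE (ℓs j) t0 = none) ∧
   (∀ j, act j → obsE (ℓs j) (ts j) = none) ∧
   ((t0 ≠ none ∧ ∀ j, act j → ts j = none) ∨
    (t0 = none ∧ ∃ j, act j ∧ ts j ≠ none ∧ ∀ j', act j' → j' ≠ j → ts j' = none)))
  ∨
  ((∃ j, act j ∧ obsE (ℓs j) t0 ≠ none) ∧
   (∀ l, act l →
     (obsE (ℓs l) t0 = none → ts l = none) ∧
     (obsE (ℓs l) t0 ≠ none → obsE (ℓs l) (ts l) = obsE (ℓs l) t0)))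

/-- validity of a composite event of the concurrent composition. -/
def ccEvent (ℓs : Fin L → T → Option Λ) (t0 : Option T) (ts : Fin L → Option T) : Prop :=
  ccEventOn ℓs (fun _ => True) t0 ts

/-- transition relation of the concurrent composition `CC_A(A0; A 0, …, A (L-1))`. -/
def ccTrans {X0 : Type*} {Xs : Fin L → Type*}
    (A0 : FSA X0 T Λ) (A : ∀ i, FSA (Xs i) T Λ) :
    (X0 × (∀ i, Xs i)) → (Option T × (Fin L → Option T)) → (X0 × (∀ i, Xs i)) → Prop :=
  fun p e q =>
    ccEvent (fun i => (A i).lbl) e.1 e.2 ∧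
    stepOpt A0.trans p.1 e.1 q.1 ∧
    ∀ i, stepOpt (A i).trans (p.2 i) (e.2 i) (q.2 i)

/-- initial states of the concurrent composition. -/
def ccInit {X0 : Type*} {Xs : Fin L → Type*}
    (A0 : FSA X0 T Λ) (A : ∀ i, FSA (Xs i) T Λ) : Set (X0 × (∀ i, Xs i)) :=
  {p | p.1 ∈ A0.init ∧ ∀ i, p.2 i ∈ (A i).init}

end CC

section Dia

/-- events of the ⋄-variant of the concurrent composition: ε, an event of `T`,
or the fresh event ⋄. -/
inductive DEv (T : Type*) where
  | eps : DEv T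
  | ev : T → DEv T
  | dia : DEv T

variable {X : Type*} {T : Type*} {Λ : Type*} {L : ℕ}

def devOf : Option T → DEv T
  | none => DEv.eps
  | some t => DEv.ev t

def devToOpt : DEv T → Option T
  | DEv.ev t => some t
  | _ => none

/-- transition relation of the variant concurrent composition
`CC_A^⋄(S; S_1, …, S_L)` of an FSA `A` with its local automata given by the
local observation maps `O i`.  A local component equal to `none` is the fresh
state ⋄. -/
def diaTrans (A : FSA X T Λ) (O : Fin L → T → Option Λ) :
    (X × (Fin L → Option X)) → (Option T × (Fin L → DEv T)) →
    (X × (Fin L → Option X)) → Prop :=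
  fun p e q =>
    -- an ordinary transition of the concurrent composition (all components in X)
    ((∃ ts : Fin L → Option T,
        (∀ i, e.2 i = devOf (ts i)) ∧
        ccEvent O e.1 ts ∧
        stepOpt A.trans p.1 e.1 q.1 ∧
        (∀ i, ∃ xi yi, p.2 i = some xi ∧ q.2 i = some yi ∧ stepOpt A.trans xi (ts i) yi)))
    ∨
    -- the extra ⋄-transitions, at states with some component differing from the 0-th
    ((∃ i, p.2 i ≠ some p.1) ∧
     (∀ i, p.2 i ≠ some p.1 → e.2 i = DEv.dia ∧ q.2 i = none) ∧
     (∃ ts : Fin L → Option T,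
        (∀ i, p.2 i = some p.1 → e.2 i = devOf (ts i)) ∧
        ((ccEventOn O (fun i => p.2 i = some p.1) e.1 ts ∧
          stepOpt A.trans p.1 e.1 q.1 ∧
          (∀ i, p.2 i = some p.1 → ∃ yi, q.2 i = some yi ∧ stepOpt A.trans p.1 (ts i) yi))
         ∨
         (e.1 = none ∧ q.1 = p.1 ∧
          (∀ i, p.2 i = some p.1 → ts i = none ∧ q.2 i = some p.1)))))

/-- initial states of the variant concurrent composition. -/
def diaInit (A : FSA X T Λ) : Set (X × (Fin L → Option X)) :=
  {p | p.1 ∈ A.init ∧ ∀ i, ∃ z ∈ A.init, p.2 i = some z}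

end Dia

/-- a (possibly partial) deterministic finite automaton. -/
structure PDFA (Q : Type*) (A : Type*) where
  start : Q
  accept : Set Q
  trans : Set (Q × A × Q)
  deterministic : ∀ q a q' q'', (q, a, q') ∈ trans → (q, a, q'') ∈ trans → q' = q''

namespace PDFA

variable {Q : Type*} {A : Type*}

def step (M : PDFA Q A) (q : Q) (a : A) (q' : Q) : Prop := (q, a, q') ∈ M.trans

def Accepts (M : PDFA Q A) (w : List A) : Prop :=
  ∃ q, RunRel M.step M.start w q ∧ q ∈ M.accept

def Acyclic (M : PDFA Q A) : Prop := ¬ ∃ (q : Q) (w : List A), w ≠ [] ∧ RunRel M.step q w q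

def Complete (M : PDFA Q A) : Prop := ∀ q a, ∃ q', (q, a, q') ∈ M.trans

def Deadlock (M : PDFA Q A) (q : Q) : Prop := ∀ a q', (q, a, q') ∉ M.trans

def DeadlockFree (M : PDFA Q A) : Prop := ∀ q, ∃ a q', (q, a, q') ∈ M.trans

end PDFA

end DES
namespace DES

/-- the FSA `S_2`: states `x_0, x_1, x_2` (as `Fin 3`), initial state `x_0`,
events `f = 0`, `u = 1` (both unobservable, label ε), transitions
`(x_0, f, x_1)`, `(x_0, u, x_2)`. -/
def S₂ : FSA (Fin 3) (Fin 2) Unit :=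
  ⟨{0}, {(0, 0, 1), (0, 1, 2)}, fun _ => none⟩

/-- `S_2` with self-loops `(x_1, u, x_1)` and `(x_2, u, x_2)` added at the two
deadlock states, where `u = 1` is an unobservable non-faulty event. -/
def S₂' : FSA (Fin 3) (Fin 2) Unit :=
  ⟨{0}, {(0, 0, 1), (0, 1, 2), (1, 1, 1), (2, 1, 2)}, fun _ => none⟩

end DES

open DES in
/-- There exists a T_f-predictable FSA with deadlock states such that adding
self-loops labelled by an unobservable non-faulty event at the deadlock states
destroys T_f-predictability: `x_1` and `x_2` are deadlock states of `S_2`, the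
self-loop event `u = 1` is unobservable and non-faulty, `S_2'` is `S_2` with
the self-loops `(x_1, u, x_1)`, `(x_2, u, x_2)` added, `S_2` is
`{f}`-predictable but `S_2'` is not. -/
theorem predictability_not_preserved_by_nonfaulty_selfloops :
    (∀ (t : Fin 2) (y : Fin 3), ¬ S₂.step 1 t y) ∧
    (∀ (t : Fin 2) (y : Fin 3), ¬ S₂.step 2 t y) ∧
    S₂'.lbl 1 = none ∧ (1 : Fin 2) ∉ ({0} : Set (Fin 2)) ∧
    S₂'.init = S₂.init ∧ S₂'.trans = S₂.trans ∪ {(1, 1, 1), (2, 1, 2)} ∧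
    S₂.Predictable {0} ∧ ¬ S₂'.Predictable {0} := by
  have hd1 : ∀ (t : Fin 2) (y : Fin 3), ¬ S₂.step 1 t y := by
    intro t y h
    simp [FSA.step, S₂] at h
  have hd2 : ∀ (t : Fin 2) (y : Fin 3), ¬ S₂.step 2 t y := by
    intro t y h
    simp [FSA.step, S₂] at h
  refine ⟨hd1, hd2, rfl, by simp, rfl, ?_, ?_, ?_⟩
  · ext x
    simp only [S₂, S₂', Set.mem_union, Set.mem_insert_iff, Set.mem_singleton_iff]
    tauto
  · refine ⟨2, fun s _ _ => ⟨[], List.nil_prefix, by simp [hasFault], ?_⟩⟩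
    intro u v huv _ _ hk
    exfalso
    have hlen : 2 ≤ (u ++ v).length := by
      rw [List.length_append]; omega
    generalize u ++ v = w at huv hlen
    obtain ⟨x0, hx0, x, hr⟩ := huv
    have hx0' : x0 = 0 := hx0
    subst hx0'
    cases hr with
    | nil => simp at hlen
    | cons h1 hr =>
      cases hr with
      | nil => simp at hlen
      | cons h2 _ =>
        simp only [FSA.step, S₂, Set.mem_insert_iff, Set.mem_singleton_iff,
          Prod.mk.injEq] at h1
        rcases h1 with ⟨_, _, rfl⟩ | ⟨_, _, rfl⟩
        · exact hd1 _ _ h2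
        · exact hd2 _ _ h2
  · rintro ⟨k, hk⟩
    have h0 : [(0 : Fin 2)] ∈ S₂'.Lang :=
      ⟨0, rfl, 1, RunRel.cons (y := 1) (by simp [FSA.step, S₂']) (RunRel.nil _)⟩
    obtain ⟨s', _, _, h⟩ := hk [0] h0 ⟨[], 0, rfl, rfl⟩
    have hloop : ∀ n, S₂'.Run 2 (List.replicate n 1) 2 := by
      intro n
      induction n with
      | zero => exact RunRel.nil _
      | succ n ih => exact RunRel.cons (y := 2) (by simp [FSA.step, S₂']) ih
    have hv : [] ++ List.replicate (k + 1) (1 : Fin 2) ∈ S₂'.Lang :=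
      ⟨0, rfl, 2, RunRel.cons (y := 2) (by simp [FSA.step, S₂']) (hloop k)⟩
    obtain ⟨t, ht, ht0⟩ := h [] _ hv (by simp [obsW, S₂']) (by simp [hasFault]) (by simp)
    have h1 := List.eq_of_mem_replicate ht
    have h2 : t = 0 := ht0
    rw [h1] at h2
    exact absurd h2 (by decide)
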